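/- There is no injective group homomorphism from the quaternion group Q₈ of order 8 into GL₃(𝔽₂), the group of invertible 3×3 matrices over the field with two elements. (This holds because a Sylow 2-subgroup of GL₃(𝔽₂) is dihedral of order 8, and Q₈ is not isomorphic to a subgroup of the dihedral group of order 8.) -/

import Mathlib

open Module

variable {V : Type*} [AddCommGroup V] [Module (ZMod 2) V]

/-- On a three-dimensional space over `𝔽₂`, two endomorphisms with the same square `N ^ 2 ≠ 0`, where
`N ^ 3 = 0`, do not have `N ^ 2` as their anticommutator. -/
theorem anticommutator_ne_sq_of_sq_eq_sq (hV : finrank (ZMod 2) V = 3) {N M : End (ZMod 2) V}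
    (h2 : N ^ 2 ≠ 0) (h3 : N ^ 3 = 0) (hNM : M ^ 2 = N ^ 2) :
    N * M + M * N ≠ N ^ 2 := by
  intro h
  obtain ⟨v, hv⟩ : ∃ v, N (N v) ≠ 0 := by
    by_contra! hc
    exact h2 (LinearMap.ext fun v => by simpa [pow_two] using hc v)
  have hN3 (w : V) : N (N (N w)) = 0 := by
    simpa [pow_succ] using LinearMap.congr_fun h3 w
  have hM2 (w : V) : M (M w) = N (N w) := by
    simpa [pow_two] using LinearMap.congr_fun hNM w
  have hanti (w : V) : N (M w) + M (N w) = N (N w) := by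
    simpa [pow_two] using LinearMap.congr_fun h w
  have hli : LinearIndependent (ZMod 2) ![v, N v, N (N v)] := by
    rw [Fintype.linearIndependent_iff]
    intro g hg
    simp only [Fin.sum_univ_three, Matrix.cons_val] at hg
    have hg0 : g 0 = 0 := by
      simpa [hN3, hv] using congrArg (fun w => N (N w)) hg
    have hg1 : g 1 = 0 := by
      simpa [hN3, hv, hg0] using congrArg N hg
    have hg2 : g 2 = 0 := by
      simpa [hv, hg0, hg1] using hg
    intro i
    fin_cases i <;> assumption
  have : FiniteDimensional (ZMod 2) V := .of_finrank_eq_succ hV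
  have hspan := hli.span_eq_top_of_card_eq_finrank' (by simp [hV])
  obtain ⟨a, b, c, habc⟩ : ∃ a b c : ZMod 2, a • v + b • N v + c • N (N v) = M v := by
    have hmem : M v ∈ Submodule.span (ZMod 2) (Set.range ![v, N v, N (N v)]) :=
      hspan ▸ Submodule.mem_top
    obtain ⟨g, hg⟩ := (Submodule.mem_span_range_iff_exists_fun _).1 hmem
    exact ⟨g 0, g 1, g 2, by simpa [Fin.sum_univ_three] using hg⟩
  have hMT : M (N (N v)) = N (N (M v)) := by rw [← hM2, ← hM2]
  have hMT_smul : M (N (N v)) = a • N (N v) := by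
    simp [hMT, ← habc, hN3]
  have ha : a = 0 := by
    simpa [hMT_smul, hN3, hv] using hM2 (N (N v))
  subst ha
  rw [zero_smul] at hMT_smul
  rw [zero_smul, zero_add] at habc
  have hMM : b • M (N v) = N (N v) := by
    rw [← hM2, ← habc]
    simp [hMT_smul]
  have hb : b = 1 := by
    refine (by decide : ∀ x : ZMod 2, x ≠ 0 → x = 1) b fun hb => hv ?_
    rw [← hMM, hb, zero_smul]
  subst hb
  have hNMv : N (M v) = N (N v) := by simp [← habc, hN3]
  have hv2 := hanti v
  rw [hNMv, ← one_smul (ZMod 2) (M (N v)), hMM] at hv2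
  exact hv (by simpa using hv2)

/-- The defining relations of `Q₈` have no faithful solution in the endomorphisms of a
three-dimensional space over `𝔽₂`. -/
theorem not_quaternion_relations_of_finrank_eq_three (hV : finrank (ZMod 2) V = 3)
    {A B : End (ZMod 2) V} (hA2 : A ^ 2 ≠ 1) (hA4 : A ^ 4 = 1) (hB : B ^ 2 = A ^ 2)
    (hAB : A * B = B * A ^ 3) : False := by
  have : FiniteDimensional (ZMod 2) V := .of_finrank_eq_succ hV
  have h0 (X : End (ZMod 2) V) : X + X = 0 := ZModModule.add_self X
  obtain ⟨N, rfl⟩ : ∃ N, A = 1 + N := ⟨A - 1, by abel⟩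
  obtain ⟨M, rfl⟩ : ∃ M, B = 1 + M := ⟨B - 1, by abel⟩
  have hsq (X : End (ZMod 2) V) : (1 + X) ^ 2 = 1 + X ^ 2 := by
    calc
      (1 + X) ^ 2 = 1 + (X + X) + X ^ 2 := by noncomm_ring
      _ = 1 + X ^ 2 := by rw [h0, add_zero]
  have hN4 : N ^ 4 = 0 := by
    rw [show 4 = 2 * 2 from rfl, pow_mul, hsq, hsq, ← pow_mul] at hA4
    simpa using hA4
  have hN3 : N ^ 3 = 0 := by
    rw [← LinearMap.ker_eq_top, ← hV, ← End.ker_pow_eq_ker_pow_finrank_of_le (m := 4) (by omega),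
      hN4, LinearMap.ker_zero]
  rw [hsq] at hA2
  rw [hsq, hsq, add_right_inj] at hB
  rw [show 3 = 1 + 2 from rfl, pow_add, pow_one, hsq] at hAB
  have hM3 : M ^ 3 = 0 := by
    rw [← LinearMap.ker_eq_top, ← hV, ← End.ker_pow_eq_ker_pow_finrank_of_le (m := 4) (by omega),
      show 4 = 2 * 2 from rfl, pow_mul, hB, ← pow_mul, hN4, LinearMap.ker_zero]
  have hMN : M * N ^ 2 = 0 := by
    rw [← hB, ← pow_succ', hM3]
  refine anticommutator_ne_sq_of_sq_eq_sq hV (by simpa using hA2) hN3 hB ?_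
  have hexp : 1 + N + M + N * M = 1 + N + M + (M * N + N ^ 2) :=
    calc
      1 + N + M + N * M = (1 + N) * (1 + M) := by noncomm_ring
      _ = (1 + M) * ((1 + N) * (1 + N ^ 2)) := hAB
      _ = 1 + N + M + M * N + N ^ 2 + N ^ 3 + M * N ^ 2 + M * N ^ 2 * N := by noncomm_ring
      _ = 1 + N + M + (M * N + N ^ 2) := by simp [hN3, hMN, add_assoc]
  rw [add_right_inj] at hexp
  rw [hexp, add_right_comm, h0, zero_add]

/-- There is no injective group homomorphism from the quaternion group `Q₈` of order 8
into `GL₃(𝔽₂)`. -/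
theorem q8_not_embeds_in_GL3_F2 :
    ¬ ∃ f : QuaternionGroup 2 →* GL (Fin 3) (ZMod 2), Function.Injective f := by
  rintro ⟨f, hf⟩
  let g : QuaternionGroup 2 →* End (ZMod 2) (Fin 3 → ZMod 2) :=
    (Matrix.toLinAlgEquiv' : Matrix (Fin 3) (Fin 3) (ZMod 2) ≃ₐ[ZMod 2] _).toMonoidHom.comp
      ((Units.coeHom _).comp f)
  have hg : Function.Injective g :=
    Matrix.toLinAlgEquiv'.injective.comp (Units.val_injective.comp hf)
  refine not_quaternion_relations_of_finrank_eq_three (A := g (.a 1)) (B := g (.xa 0)) (by simp)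
    ?_ ?_ ?_ ?_
  · rw [← map_pow, ← map_one g, hg.ne_iff]
    decide
  all_goals
    simp only [← map_pow, ← map_mul, ← map_one g]
    congr 1
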